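/- arXiv:2510.08473 — 2 statements merged into one kernel-verified Lean document; each statement's English description precedes it below -/
import Mathlib

section
/- Let κ ∈ (0, π/4) and κ′ > 0. For every c > 0 there exists D ∈ ℕ such that for all integers d ≥ D, all α, β, θ ∈ [κ, π/2 − κ] satisfying κ′ ≤ γ² ≤ 1 − κ′ where γ² := (cos²α + cos²β − 2·cos α·cos β·cos θ)/sin²θ, and all x, y ∈ S^{d−1} with |⟨x, y⟩ − cos θ| ≤ (log₂ d)^{−2}: 2^{−c·d}·(1 − γ²)^{d/2} ≤ σ_d({w ∈ S^{d−1} : |⟨x, w⟩ − cos α| ≤ (log₂ d)^{−2} and |⟨y, w⟩ − cos β| ≤ (log₂ d)^{−2}}) ≤ 2^{c·d}·(1 − γ²)^{d/2}. -/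
open MeasureTheory
open scoped RealInnerProductSpace

/-- `σ` is the uniform (normalized rotation-invariant) probability measure on the unit sphere
`S^{d−1} ⊆ ℝ^d`, viewed as a measure on `ℝ^d` concentrated on the sphere. -/
def IsUniformSphereMeasure (d : ℕ) (σ : Measure (EuclideanSpace ℝ (Fin d))) : Prop :=
  IsProbabilityMeasure σ ∧ σ (Metric.sphere (0 : EuclideanSpace ℝ (Fin d)) 1) = 1 ∧
    ∀ O : EuclideanSpace ℝ (Fin d) ≃ₗᵢ[ℝ] EuclideanSpace ℝ (Fin d), Measure.map (⇑O) σ = σ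

namespace Wedge

lemma ae_norm {d : ℕ} {σ : Measure (EuclideanSpace ℝ (Fin d))}
    (h : IsUniformSphereMeasure d σ) : ∀ᵐ w ∂σ, ‖w‖ = 1 := by
  have := h.1
  have h1 : ∀ᵐ w ∂σ, w ∈ Metric.sphere (0 : EuclideanSpace ℝ (Fin d)) 1 :=
    (mem_ae_iff_prob_eq_one Metric.isClosed_sphere.measurableSet).2 h.2.1
  filter_upwards [h1] with w hw
  simpa using hw

lemma charFun_eq_of_norm {d : ℕ} {σ : Measure (EuclideanSpace ℝ (Fin d))}
    (h : IsUniformSphereMeasure d σ) {u v : EuclideanSpace ℝ (Fin d)} (huv : ‖u‖ = ‖v‖) :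
    charFun σ u = charFun σ v := by
  obtain ⟨O, hO⟩ : ∃ O : EuclideanSpace ℝ (Fin d) ≃ₗᵢ[ℝ] EuclideanSpace ℝ (Fin d), O u = v :=
    ⟨_, Submodule.reflection_sub huv⟩
  have h2 := h.2.2 O
  rw [charFun_apply, charFun_apply]
  conv_rhs => rw [← h2]
  rw [integral_map (by fun_prop) (by fun_prop)]
  simp only [← hO, LinearIsometryEquiv.inner_map_map]

lemma unique_uniform {d : ℕ} {σ τ : Measure (EuclideanSpace ℝ (Fin d))}
    (hσ : IsUniformSphereMeasure d σ) (hτ : IsUniformSphereMeasure d τ) : σ = τ := by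
  have := hσ.1
  have := hτ.1
  apply Measure.ext_of_charFun
  funext t
  have key : ∀ {σ τ : Measure (EuclideanSpace ℝ (Fin d))}, IsUniformSphereMeasure d σ →
      IsUniformSphereMeasure d τ → ∫ u, charFun σ (‖t‖ • u) ∂τ = charFun σ t := by
    intro σ τ hσ hτ
    have := hσ.1
    have := hτ.1
    have : ∀ᵐ u ∂τ, charFun σ (‖t‖ • u) = charFun σ t := by
      filter_upwards [ae_norm hτ] with u hu
      exact charFun_eq_of_norm hσ (by simp [norm_smul, hu])
    rw [integral_congr_ae this]
    simp
  rw [← key hσ hτ, ← key hτ hσ]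
  simp only [charFun_apply]
  rw [integral_integral_swap]
  · simp only [inner_smul_right, real_inner_comm]
  · refine (integrable_const (1 : ℝ)).mono' (by apply Continuous.aestronglyMeasurable; fun_prop) ?_
    refine Filter.Eventually.of_forall fun p => ?_
    simp [Function.uncurry, Complex.norm_exp]

/-- annulus -/
def ann (d : ℕ) (η : ℝ) : Set (EuclideanSpace ℝ (Fin d)) :=
  Metric.closedBall 0 (1 + η) \ Metric.closedBall 0 (1 - η)

lemma mem_ann {d : ℕ} {η : ℝ} {v : EuclideanSpace ℝ (Fin d)} :
    v ∈ ann d η ↔ ‖v‖ ≤ 1 + η ∧ 1 - η < ‖v‖ := by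
  simp [ann]

/-- normalisation -/
noncomputable def nrm {d : ℕ} (v : EuclideanSpace ℝ (Fin d)) : EuclideanSpace ℝ (Fin d) :=
  ‖v‖⁻¹ • v

lemma measurable_nrm {d : ℕ} : Measurable (nrm (d := d)) := by
  unfold nrm; fun_prop

lemma measurableSet_ann (d : ℕ) (η : ℝ) : MeasurableSet (ann d η) :=
  Metric.isClosed_closedBall.measurableSet.diff Metric.isClosed_closedBall.measurableSet

lemma vol_ann_ne_top (d : ℕ) (η : ℝ) : volume (ann d η) ≠ ⊤ :=
  ((measure_mono Set.sdiff_subset).trans_lt measure_closedBall_lt_top).ne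

lemma vol_ann {d : ℕ} {η : ℝ} (h0 : 0 < η) (h1 : η < 1) :
    volume.real (ann d η) = ((1 + η) ^ d - (1 - η) ^ d) *
      volume.real (Metric.ball (0 : EuclideanSpace ℝ (Fin d)) 1) := by
  unfold ann
  rw [measureReal_sdiff (Metric.closedBall_subset_closedBall (by linarith))
    Metric.isClosed_closedBall.measurableSet measure_closedBall_lt_top.ne,
    Measure.addHaar_real_closedBall _ _ (by linarith),
    Measure.addHaar_real_closedBall _ _ (by linarith)]
  simp
  ring

lemma vol_unit_pos (d : ℕ) :
    0 < volume.real (Metric.ball (0 : EuclideanSpace ℝ (Fin d)) 1) :=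
  ENNReal.toReal_pos (Metric.measure_ball_pos _ _ one_pos).ne' measure_ball_lt_top.ne

lemma vol_ann_pos {d : ℕ} (hd : d ≠ 0) {η : ℝ} (h0 : 0 < η) (h1 : η < 1) :
    0 < volume.real (ann d η) := by
  rw [vol_ann h0 h1]
  apply mul_pos _ (vol_unit_pos d)
  have : (1 - η) ^ d < (1 + η) ^ d := pow_lt_pow_left₀ (by linarith) (by linarith) hd
  linarith

lemma uniform_ann {d : ℕ} (hd : d ≠ 0) {η : ℝ} (h0 : 0 < η) (h1 : η < 1) :
    IsUniformSphereMeasure d (Measure.map nrm (ProbabilityTheory.cond volume (ann d η))) := by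
  have hne : volume (ann d η) ≠ 0 := by
    intro h
    have := vol_ann_pos hd h0 h1
    simp [measureReal_def, h] at this
  have := ProbabilityTheory.cond_isProbabilityMeasure_of_finite hne (vol_ann_ne_top d η)
  refine ⟨Measure.isProbabilityMeasure_map measurable_nrm.aemeasurable, ?_, ?_⟩
  · rw [Measure.map_apply measurable_nrm Metric.isClosed_sphere.measurableSet,
      ProbabilityTheory.cond_apply (measurableSet_ann d η)]
    rw [Set.inter_eq_left.2]
    · exact ENNReal.inv_mul_cancel hne (vol_ann_ne_top d η)
    · intro v hv
      rw [mem_ann] at hv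
      have : ‖v‖ ≠ 0 := by linarith
      simp [nrm, norm_smul, this]
  · intro O
    have hO : Measurable O := O.continuous.measurable
    ext S hS
    rw [Measure.map_apply hO hS, Measure.map_apply measurable_nrm (hO hS),
      Measure.map_apply measurable_nrm hS, ProbabilityTheory.cond_apply (measurableSet_ann d η),
      ProbabilityTheory.cond_apply (measurableSet_ann d η)]
    congr 1
    rw [← O.measurePreserving.measure_preimage
      ((measurableSet_ann d η).inter (measurable_nrm hS)).nullMeasurableSet]
    congr 1
    ext v
    simp [mem_ann, nrm]

lemma sigma_eq {d : ℕ} (hd : d ≠ 0) {η : ℝ} (h0 : 0 < η) (h1 : η < 1)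
    {σ : Measure (EuclideanSpace ℝ (Fin d))} (hσ : IsUniformSphereMeasure d σ)
    {W : Set (EuclideanSpace ℝ (Fin d))} (hW : MeasurableSet W) :
    (σ W).toReal * volume.real (ann d η) = volume.real (ann d η ∩ nrm ⁻¹' W) := by
  rw [unique_uniform hσ (uniform_ann hd h0 h1), Measure.map_apply measurable_nrm hW,
    ProbabilityTheory.cond_apply (measurableSet_ann d η), ENNReal.toReal_mul, ENNReal.toReal_inv]
  have := vol_ann_pos hd h0 h1
  simp only [← measureReal_def]
  field_simp

/-- the approximate wedge -/
def wedge {d : ℕ} (x y : EuclideanSpace ℝ (Fin d)) (A B ε : ℝ) :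
    Set (EuclideanSpace ℝ (Fin d)) :=
  {w | ‖w‖ = 1 ∧ |⟪x, w⟫ - A| ≤ ε ∧ |⟪y, w⟫ - B| ≤ ε}

lemma measurableSet_wedge {d : ℕ} (x y : EuclideanSpace ℝ (Fin d)) (A B ε : ℝ) :
    MeasurableSet (wedge x y A B ε) := by
  apply IsClosed.measurableSet
  unfold wedge
  refine IsClosed.and (isClosed_eq (by fun_prop) (by fun_prop)) (IsClosed.and
    (isClosed_le (by fun_prop) (by fun_prop)) (isClosed_le (by fun_prop) (by fun_prop)))

lemma comb_bound {a b u v C ε : ℝ} (hab : |a| + |b| ≤ C) (hε : 0 ≤ ε) (hu : |u| ≤ ε)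
    (hv : |v| ≤ ε) : |a * u + b * v| ≤ C * ε := by
  calc |a * u + b * v| ≤ |a * u| + |b * v| := abs_add_le _ _
    _ = |a| * |u| + |b| * |v| := by rw [abs_mul, abs_mul]
    _ ≤ |a| * ε + |b| * ε := by gcongr
    _ = (|a| + |b|) * ε := by ring
    _ ≤ C * ε := by gcongr

lemma upper {d : ℕ} (hd : d ≠ 0) {η : ℝ} (h0 : 0 < η) (h1 : η < 1)
    {σ : Measure (EuclideanSpace ℝ (Fin d))} (hσ : IsUniformSphereMeasure d σ)
    {x y : EuclideanSpace ℝ (Fin d)} {A B a b C ε R : ℝ} (hε : 0 ≤ ε)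
    (hx : ⟪x, a • x + b • y⟫ = A) (hy : ⟪y, a • x + b • y⟫ = B)
    (hab : |a| + |b| ≤ C) (hη : (1 - η) ^ d ≤ 1 / 2) (hR : 0 ≤ R)
    (hR2 : 1 - ‖a • x + b • y‖ ^ 2 + 2 * C * ε ≤ R ^ 2) :
    (σ (wedge x y A B ε)).toReal ≤ 2 * (η + R) ^ d := by
  have key := sigma_eq hd h0 h1 hσ (measurableSet_wedge x y A B ε)
  have hV := vol_unit_pos d
  set p := a • x + b • y with hp
  have hpn : ‖p‖ ^ 2 = a * A + b * B := by
    rw [← real_inner_self_eq_norm_sq]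
    nth_rewrite 1 [hp]
    rw [inner_add_left, inner_smul_left, inner_smul_left, hx, hy]
    simp
  have hsub : ann d η ∩ nrm ⁻¹' (wedge x y A B ε) ⊆ Metric.closedBall p (η + R) := by
    rintro v ⟨hv, hw⟩
    rw [mem_ann] at hv
    have hv0 : 0 < ‖v‖ := by linarith
    set w := nrm v with hwdef
    have hvw : v = ‖v‖ • w := by
      rw [hwdef, nrm, smul_smul, mul_inv_cancel₀ hv0.ne', one_smul]
    obtain ⟨hw1, hwx, hwy⟩ := hw
    have e1 : ‖v - w‖ ≤ η := by
      have : v - w = (‖v‖ - 1) • w := by rw [sub_smul, ← hvw, one_smul]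
      rw [this, norm_smul, hw1, mul_one, Real.norm_eq_abs, abs_le]
      constructor <;> linarith
    have e2 : ‖w - p‖ ≤ R := by
      apply le_of_sq_le_sq _ hR
      rw [norm_sub_sq_real, hw1]
      have : ⟪w, p⟫ = a * ⟪x, w⟫ + b * ⟪y, w⟫ := by
        rw [hp, inner_add_right, inner_smul_right, inner_smul_right, real_inner_comm w x,
          real_inner_comm w y]
      have h3 := abs_le.1 (comb_bound hab hε hwx hwy)
      nlinarith [h3.1]
    rw [Metric.mem_closedBall, dist_eq_norm]
    calc ‖v - p‖ = ‖(v - w) + (w - p)‖ := by congr 1; abel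
      _ ≤ _ := (norm_add_le _ _).trans (add_le_add e1 e2)
  have h2 : volume.real (ann d η ∩ nrm ⁻¹' (wedge x y A B ε)) ≤
      (η + R) ^ d * volume.real (Metric.ball (0 : EuclideanSpace ℝ (Fin d)) 1) := by
    refine (measureReal_mono hsub measure_closedBall_lt_top.ne).trans ?_
    rw [Measure.addHaar_real_closedBall _ _ (by linarith)]
    simp
  have h3 : 1 / 2 * volume.real (Metric.ball (0 : EuclideanSpace ℝ (Fin d)) 1) ≤
      volume.real (ann d η) := by
    rw [vol_ann h0 h1]
    gcongr
    have : 1 ≤ (1 + η) ^ d := one_le_pow₀ (by linarith)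
    linarith
  have h4 : (σ (wedge x y A B ε)).toReal *
      (1 / 2 * volume.real (Metric.ball (0 : EuclideanSpace ℝ (Fin d)) 1)) ≤
      (η + R) ^ d * volume.real (Metric.ball (0 : EuclideanSpace ℝ (Fin d)) 1) := by
    refine le_trans ?_ (key.le.trans h2)
    gcongr
  rw [← mul_assoc] at h4
  have := le_of_mul_le_mul_right h4 hV
  linarith

lemma cap {d : ℕ} {x p : EuclideanSpace ℝ (Fin d)} (hx : ‖x‖ = 1) {ρ t : ℝ} (hρ : 0 ≤ ρ)
    (ht0 : 0 ≤ t) (ht1 : t ≤ 1) :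
    volume.real {v | v ∈ Metric.closedBall p ρ ∧ t * ρ ≤ ⟪v - p, x⟫} ≤
      Real.sqrt (1 - t ^ 2) ^ d * (ρ ^ d *
        volume.real (Metric.ball (0 : EuclideanSpace ℝ (Fin d)) 1)) := by
  have hs : 0 ≤ 1 - t ^ 2 := by nlinarith
  have hsub : {v | v ∈ Metric.closedBall p ρ ∧ t * ρ ≤ ⟪v - p, x⟫} ⊆
      Metric.closedBall (p + (t * ρ) • x) (Real.sqrt (1 - t ^ 2) * ρ) := by
    rintro v ⟨hv, hvx⟩
    rw [Metric.mem_closedBall, dist_eq_norm] at hv ⊢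
    apply le_of_sq_le_sq _ (by positivity)
    have : v - (p + (t * ρ) • x) = (v - p) - (t * ρ) • x := by abel
    rw [this, norm_sub_sq_real, inner_smul_right, norm_smul, hx, mul_one, mul_pow,
      Real.sq_sqrt hs, Real.norm_eq_abs, sq_abs]
    have h1 : ‖v - p‖ ^ 2 ≤ ρ ^ 2 := by gcongr
    have h2 : (t * ρ) * (t * ρ) ≤ (t * ρ) * ⟪v - p, x⟫ := by gcongr
    nlinarith
  refine (measureReal_mono hsub measure_closedBall_lt_top.ne).trans ?_
  rw [Measure.addHaar_real_closedBall _ _ (by positivity)]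
  simp [mul_pow, mul_assoc]

set_option maxHeartbeats 1000000 in
lemma lower {d : ℕ} (hd : d ≠ 0) {η : ℝ} (h0 : 0 < η) (h1 : η < 1)
    {σ : Measure (EuclideanSpace ℝ (Fin d))} (hσ : IsUniformSphereMeasure d σ)
    {x y : EuclideanSpace ℝ (Fin d)} (hx1 : ‖x‖ = 1) (hy1 : ‖y‖ = 1)
    {A B a b C ε ρ t : ℝ} (hA : |A| ≤ 1) (hB : |B| ≤ 1)
    (hx : ⟪x, a • x + b • y⟫ = A) (hy : ⟪y, a • x + b • y⟫ = B)
    (hab : |a| + |b| ≤ C) (hρ : 0 < ρ)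
    (hρ2 : ρ ^ 2 = 1 - ‖a • x + b • y‖ ^ 2) (ht0 : 0 < t) (ht1 : t ≤ 1)
    (ht2 : (2 * C + 2) * t < η) (ht3 : (2 * C + 2) * t ≤ 1 / 2)
    (ht4 : 2 * (2 * C + 3) * t ≤ ε) (ht5 : 5 * Real.sqrt (1 - t ^ 2) ^ d ≤ 1 / 2) :
    ρ ^ d ≤ 2 * (1 + η) ^ d * (σ (wedge x y A B ε)).toReal := by
  have key := sigma_eq hd h0 h1 hσ (measurableSet_wedge x y A B ε)
  have hV := vol_unit_pos d
  set p := a • x + b • y with hp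
  have hρ1 : ρ ≤ 1 := by nlinarith [sq_nonneg ‖p‖]
  have hC : 0 ≤ C := le_trans (by positivity) hab
  set V := volume.real (Metric.ball (0 : EuclideanSpace ℝ (Fin d)) 1) with hVdef
  set S1 := {v | v ∈ Metric.closedBall p ρ ∧ t * ρ ≤ ⟪v - p, x⟫}
  set S2 := {v | v ∈ Metric.closedBall p ρ ∧ t * ρ ≤ ⟪v - p, -x⟫}
  set S3 := {v | v ∈ Metric.closedBall p ρ ∧ t * ρ ≤ ⟪v - p, y⟫}
  set S4 := {v | v ∈ Metric.closedBall p ρ ∧ t * ρ ≤ ⟪v - p, -y⟫}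
  set S5 := Metric.closedBall p ((1 - t) * ρ)
  set G := ann d η ∩ nrm ⁻¹' (wedge x y A B ε)
  have hsub : Metric.closedBall p ρ ⊆ G ∪ (S1 ∪ (S2 ∪ (S3 ∪ (S4 ∪ S5)))) := by
    intro v hv
    by_contra hcon
    simp only [Set.mem_union, not_or] at hcon
    obtain ⟨hG, n1, n2, n3, n4, n5⟩ := hcon
    have m1 : ⟪v - p, x⟫ < t * ρ := by by_contra hh; exact n1 ⟨hv, not_lt.1 hh⟩
    have m2 : ⟪v - p, -x⟫ < t * ρ := by by_contra hh; exact n2 ⟨hv, not_lt.1 hh⟩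
    have m3 : ⟪v - p, y⟫ < t * ρ := by by_contra hh; exact n3 ⟨hv, not_lt.1 hh⟩
    have m4 : ⟪v - p, -y⟫ < t * ρ := by by_contra hh; exact n4 ⟨hv, not_lt.1 hh⟩
    have m5 : (1 - t) * ρ < ‖v - p‖ := by
      by_contra hh
      apply n5
      rw [Metric.mem_closedBall, dist_eq_norm]
      exact not_lt.1 hh
    apply hG
    rw [Metric.mem_closedBall, dist_eq_norm] at hv
    rw [inner_neg_right] at m2 m4
    set h := v - p with hh
    have hvp : v = p + h := by rw [hh]; abel
    have htρ : t * ρ ≤ t := by nlinarith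
    have k1 : |⟪x, h⟫| ≤ t := by
      rw [real_inner_comm, abs_le]; constructor <;> linarith
    have k2 : |⟪y, h⟫| ≤ t := by
      rw [real_inner_comm, abs_le]; constructor <;> linarith
    have k3 : |⟪p, h⟫| ≤ C * t := by
      rw [hp, inner_add_left, real_inner_smul_left, real_inner_smul_left]
      exact comb_bound hab ht0.le k1 k2
    have k4 : ‖v‖ ^ 2 = ‖p‖ ^ 2 + 2 * ⟪p, h⟫ + ‖h‖ ^ 2 := by
      rw [hvp, norm_add_sq_real]
    have k5 : ‖h‖ ^ 2 ≤ ρ ^ 2 := by gcongr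
    have k6 : ((1 - t) * ρ) ^ 2 ≤ ‖h‖ ^ 2 := by
      have : 0 ≤ (1 - t) * ρ := mul_nonneg (by linarith) hρ.le
      gcongr
    have k7 : ρ ^ 2 - 2 * t ≤ ((1 - t) * ρ) ^ 2 := by
      have : ρ ^ 2 ≤ 1 := by nlinarith
      nlinarith [mul_nonneg ht0.le (sub_nonneg.2 this), sq_nonneg (t * ρ)]
    have k8 : |‖v‖ ^ 2 - 1| ≤ (2 * C + 2) * t := by
      have := abs_le.1 k3
      rw [abs_le]; constructor <;> nlinarith
    have k9 : |‖v‖ - 1| ≤ (2 * C + 2) * t := by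
      refine le_trans ?_ k8
      have : ‖v‖ ^ 2 - 1 = (‖v‖ - 1) * (‖v‖ + 1) := by ring
      rw [this, abs_mul]
      have h2 : 1 ≤ |‖v‖ + 1| := by
        rw [abs_of_nonneg (by positivity)]; linarith [norm_nonneg v]
      nlinarith [abs_nonneg (‖v‖ - 1)]
    have k10 := abs_le.1 k9
    have hv0 : 1 / 2 ≤ ‖v‖ := by linarith [k10.1]
    have hvpos : 0 < ‖v‖ := by linarith
    have main : ∀ (z : EuclideanSpace ℝ (Fin d)) (Z : ℝ), |Z| ≤ 1 → ⟪z, p⟫ = Z → |⟪z, h⟫| ≤ t →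
        |⟪z, nrm v⟫ - Z| ≤ ε := by
      intro z Z hZ hz hzt
      have e1 : ⟪z, nrm v⟫ - Z = (⟪z, h⟫ - (‖v‖ - 1) * Z) / ‖v‖ := by
        rw [nrm, inner_smul_right]
        nth_rewrite 2 [hvp]
        rw [inner_add_right, hz]
        field_simp
        ring
      rw [e1, abs_div, abs_of_pos hvpos, div_le_iff₀ hvpos]
      calc |⟪z, h⟫ - (‖v‖ - 1) * Z| ≤ |⟪z, h⟫| + |(‖v‖ - 1) * Z| := abs_sub _ _
        _ ≤ t + (2 * C + 2) * t * 1 := by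
          rw [abs_mul]; gcongr
        _ ≤ ε * (1 / 2) := by linarith
        _ ≤ ε * ‖v‖ := by
          have : 0 ≤ ε := le_trans (by positivity) ht4
          gcongr
    refine ⟨mem_ann.2 ⟨by linarith [k10.2], by linarith [k10.1]⟩, ?_, main x A hA hx k1,
      main y B hB hy k2⟩
    rw [nrm, norm_smul, norm_inv, norm_norm, inv_mul_cancel₀ hvpos.ne']
  have hGt : volume G ≠ ⊤ :=
    ((measure_mono Set.inter_subset_left).trans_lt (vol_ann_ne_top d η).lt_top).ne
  have c1 := cap (p := p) hx1 hρ.le ht0.le ht1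
  have c2 := cap (p := p) (x := -x) (by simpa using hx1) hρ.le ht0.le ht1
  have c3 := cap (p := p) hy1 hρ.le ht0.le ht1
  have c4 := cap (p := p) (x := -y) (by simpa using hy1) hρ.le ht0.le ht1
  have c5 : volume.real S5 ≤ Real.sqrt (1 - t ^ 2) ^ d * (ρ ^ d * V) := by
    have ht1' : 0 ≤ 1 - t := by linarith
    rw [Measure.addHaar_real_closedBall _ _ (mul_nonneg (by linarith) hρ.le), mul_pow,
      mul_assoc]
    simp only [finrank_euclideanSpace, Fintype.card_fin]
    gcongr
    apply Real.le_sqrt_of_sq_le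
    nlinarith
  have tot : ρ ^ d * V ≤ volume.real G + 5 * (Real.sqrt (1 - t ^ 2) ^ d * (ρ ^ d * V)) := by
    have f : ∀ {S : Set (EuclideanSpace ℝ (Fin d))}, S ⊆ Metric.closedBall p ρ → volume S ≠ ⊤ :=
      fun hS => ((measure_mono hS).trans_lt measure_closedBall_lt_top).ne
    have f1 : volume S1 ≠ ⊤ := f fun v hv => hv.1
    have f2 : volume S2 ≠ ⊤ := f fun v hv => hv.1
    have f3 : volume S3 ≠ ⊤ := f fun v hv => hv.1
    have f4 : volume S4 ≠ ⊤ := f fun v hv => hv.1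
    have f5 : volume S5 ≠ ⊤ := measure_closedBall_lt_top.ne
    have g := measureReal_mono hsub (by
      simp only [ne_eq, measure_union_eq_top_iff, not_or]
      exact ⟨hGt, f1, f2, f3, f4, f5⟩)
    rw [Measure.addHaar_real_closedBall _ _ hρ.le] at g
    simp only [finrank_euclideanSpace, Fintype.card_fin] at g
    have u1 := measureReal_union_le (μ := volume) G (S1 ∪ (S2 ∪ (S3 ∪ (S4 ∪ S5))))
    have u2 := measureReal_union_le (μ := volume) S1 (S2 ∪ (S3 ∪ (S4 ∪ S5)))
    have u3 := measureReal_union_le (μ := volume) S2 (S3 ∪ (S4 ∪ S5))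
    have u4 := measureReal_union_le (μ := volume) S3 (S4 ∪ S5)
    have u5 := measureReal_union_le (μ := volume) S4 S5
    linarith
  have h6 : 1 / 2 * (ρ ^ d * V) ≤ volume.real G := by
    have : 5 * Real.sqrt (1 - t ^ 2) ^ d * (ρ ^ d * V) ≤ 1 / 2 * (ρ ^ d * V) := by gcongr
    linarith
  have h7 : volume.real G ≤ (σ (wedge x y A B ε)).toReal * ((1 + η) ^ d * V) := by
    rw [← key, vol_ann h0 h1]
    gcongr
    have : 0 ≤ (1 - η) ^ d := pow_nonneg (by linarith) _
    linarith
  have h8 := h6.trans h7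
  have h9 : (1 / 2 * ρ ^ d) * V ≤ ((σ (wedge x y A B ε)).toReal * (1 + η) ^ d) * V := by
    linarith
  have := le_of_mul_le_mul_right h9 hV
  linarith

lemma ev_eps : Filter.Tendsto (fun d : ℕ => ((Real.logb 2 d) ^ 2)⁻¹) Filter.atTop (nhds 0) := by
  apply Filter.Tendsto.inv_tendsto_atTop
  apply (Filter.tendsto_pow_atTop two_ne_zero).comp
  exact (Real.tendsto_logb_atTop one_lt_two).comp tendsto_natCast_atTop_atTop

lemma ev_big (M : ℝ) : ∀ᶠ d : ℕ in Filter.atTop, M ≤ (d : ℝ) * (((Real.logb 2 d) ^ 2)⁻¹) ^ 2 := by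
  have h := (Real.tendsto_pow_logb_div_mul_add_atTop (b := 2) 1 0 4 one_ne_zero).comp
    (tendsto_natCast_atTop_atTop (R := ℝ))
  have h2 := h.eventually (gt_mem_nhds (show (0 : ℝ) < (|M| + 1)⁻¹ by positivity))
  filter_upwards [h2, Filter.eventually_ge_atTop 2] with d hd hd2
  have hd0 : (2 : ℝ) ≤ d := by exact_mod_cast hd2
  have hL : 0 < Real.logb 2 d := Real.logb_pos one_lt_two (by linarith)
  simp only [Function.comp, one_mul, add_zero] at hd
  rw [div_lt_iff₀ (by linarith), inv_mul_eq_div, lt_div_iff₀ (by positivity)] at hd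
  rw [← inv_pow, ← pow_mul, inv_pow, ← div_eq_mul_inv, le_div_iff₀ (by positivity)]
  have : M * Real.logb 2 d ^ (2 * 2) ≤ (|M| + 1) * Real.logb 2 d ^ 4 := by
    norm_num
    gcongr
    linarith [le_abs_self M]
  linarith

lemma sqrt_pow_small {d : ℕ} {t : ℝ} (ht : 20 ≤ d * t ^ 2) :
    5 * Real.sqrt (1 - t ^ 2) ^ d ≤ 1 / 2 := by
  have h1 : Real.sqrt (1 - t ^ 2) ≤ Real.exp (-(t ^ 2 / 2)) := by
    apply Real.sqrt_le_iff.2 ⟨by positivity, ?_⟩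
    rw [← Real.exp_nat_mul]
    have := Real.add_one_le_exp (-(t ^ 2))
    have e : ((2 : ℕ) : ℝ) * (-(t ^ 2 / 2)) = -(t ^ 2) := by push_cast; ring
    rw [e]; linarith
  have h2 : Real.sqrt (1 - t ^ 2) ^ d ≤ Real.exp (-10) := by
    calc _ ≤ Real.exp (-(t ^ 2 / 2)) ^ d := by gcongr
      _ = Real.exp (d * -(t ^ 2 / 2)) := by rw [← Real.exp_nat_mul]
      _ ≤ _ := by apply Real.exp_le_exp.2; linarith
  have h3 : Real.exp (-10) ≤ 1 / 10 := by
    rw [Real.exp_neg, one_div]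
    apply inv_anti₀ (by norm_num)
    linarith [Real.add_one_le_exp (10 : ℝ)]
  linarith

set_option maxHeartbeats 2000000 in
/-- All the analysis for one fixed `d`. -/
lemma core {d : ℕ} (hd : d ≠ 0) {σ : Measure (EuclideanSpace ℝ (Fin d))}
    (hσ : IsUniformSphereMeasure d σ) {x y : EuclideanSpace ℝ (Fin d)} (hx1 : ‖x‖ = 1)
    (hy1 : ‖y‖ = 1) {A B T m g ε η κ' Q : ℝ} (hA0 : 0 ≤ A) (hA1 : A ≤ 1) (hB0 : 0 ≤ B)
    (hB1 : B ≤ 1) (hT0 : 0 ≤ T) (hT1 : T ≤ 1) (hm : 0 < m) (hm1 : m ≤ 1 / 2)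
    (hTm : 2 * m ≤ 1 - T ^ 2) (hg : g * (1 - T ^ 2) = A ^ 2 + B ^ 2 - 2 * A * B * T)
    (hκ' : 0 < κ') (hg0 : κ' ≤ g) (hg1 : g ≤ 1 - κ')
    (hη0 : 0 < η) (hη1 : η ≤ 1 / 2) (hQ : 1 < Q) (hηQ : η * (Q + 1) ≤ (Q - 1) * Real.sqrt κ')
    (hε0 : 0 < ε) (hε : ε ≤ m * η ^ 2 / 16)
    (hbig : 20 * (2 * (2 * (4 / m) + 3)) ^ 2 ≤ d * ε ^ 2)
    (hηd : (1 - η) ^ d ≤ 1 / 2) (hQd : 2 ≤ Q ^ d) (hxy : |⟪x, y⟫ - T| ≤ ε) :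
    Real.sqrt (1 - g) ^ d ≤ (Q ^ 2) ^ d * (σ (wedge x y A B ε)).toReal ∧
    (σ (wedge x y A B ε)).toReal ≤ (Q ^ 2) ^ d * Real.sqrt (1 - g) ^ d := by
  set s := ⟪x, y⟫ with hs
  have hs1 : |s| ≤ 1 := by
    have := abs_real_inner_le_norm x y
    rwa [hx1, hy1, one_mul] at this
  have hη2 : η ^ 2 ≤ η := by nlinarith
  have hmη : m * η ^ 2 ≤ m * 1 := by gcongr; linarith
  have hmη2 : m * η ^ 2 ≤ 1 * η := by gcongr; linarith
  have hεm : ε ≤ m / 2 := by linarith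
  have hεη : ε < η := by linarith
  have hε2 : ε ≤ 1 / 2 := by linarith
  have hsT : |s ^ 2 - T ^ 2| ≤ 2 * ε := by
    have : s ^ 2 - T ^ 2 = (s - T) * (s + T) := by ring
    rw [this, abs_mul]
    have h2 : |s + T| ≤ 2 := (abs_add_le _ _).trans (by rw [abs_of_nonneg hT0]; linarith)
    nlinarith [abs_nonneg (s - T), abs_nonneg (s + T)]
  have hsm : m ≤ 1 - s ^ 2 := by linarith [(abs_le.1 hsT).2]
  have hs0 : 0 < 1 - s ^ 2 := by linarith
  set a := (A - s * B) / (1 - s ^ 2) with ha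
  set b := (B - s * A) / (1 - s ^ 2) with hb
  have hbd : ∀ {u v : ℝ}, 0 ≤ u → u ≤ 1 → 0 ≤ v → v ≤ 1 → |(u - s * v) / (1 - s ^ 2)| ≤ 2 / m := by
    intro u v hu0 hu1 hv0 hv1
    rw [abs_div, abs_of_pos hs0]
    apply div_le_div₀ (by norm_num) _ hm hsm
    calc |u - s * v| ≤ |u| + |s * v| := abs_sub _ _
      _ ≤ 2 := by
        rw [abs_mul, abs_of_nonneg hu0, abs_of_nonneg hv0]
        nlinarith [abs_nonneg s]
  have hab : |a| + |b| ≤ 4 / m := by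
    have h1 := hbd hA0 hA1 hB0 hB1
    have h2 := hbd hB0 hB1 hA0 hA1
    have : 4 / m = 2 / m + 2 / m := by ring
    rw [this]
    exact add_le_add h1 h2
  have hxx : ⟪x, x⟫ = 1 := by rw [real_inner_self_eq_norm_sq, hx1]; norm_num
  have hyy : ⟪y, y⟫ = 1 := by rw [real_inner_self_eq_norm_sq, hy1]; norm_num
  have hx : ⟪x, a • x + b • y⟫ = A := by
    rw [inner_add_right, inner_smul_right, inner_smul_right, hxx, ← hs, ha, hb]
    field_simp
    ring
  have hy : ⟪y, a • x + b • y⟫ = B := by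
    rw [inner_add_right, inner_smul_right, inner_smul_right, hyy, real_inner_comm, ← hs, ha, hb]
    field_simp
    ring
  have hpn : ‖a • x + b • y‖ ^ 2 = a * A + b * B := by
    rw [← real_inner_self_eq_norm_sq]
    nth_rewrite 1 [inner_add_left]
    rw [real_inner_smul_left, real_inner_smul_left, hx, hy]
  set G := ‖a • x + b • y‖ ^ 2 with hG
  have hGs : G * (1 - s ^ 2) = A ^ 2 + B ^ 2 - 2 * A * B * s := by
    rw [hpn, ha, hb]
    field_simp
    ring
  have hAB : A * B ≤ 1 := mul_le_one₀ hA1 hB0 hB1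
  have hAB0 : 0 ≤ A * B := by positivity
  have hGg : |G - g| ≤ η ^ 2 / 4 := by
    have e : (G - g) * (1 - s ^ 2) = 2 * (A * B) * (T - s) + g * (s ^ 2 - T ^ 2) := by
      linear_combination hGs - hg
    have e2 : |G - g| * (1 - s ^ 2) ≤ 4 * ε := by
      have e0 : |G - g| * (1 - s ^ 2) = |(G - g) * (1 - s ^ 2)| := by
        rw [abs_mul, abs_of_pos hs0]
      rw [e0, e]
      refine (abs_add_le _ _).trans ?_
      rw [abs_mul, abs_mul g, abs_of_nonneg (by positivity : 0 ≤ 2 * (A * B)),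
        abs_of_nonneg (by linarith : 0 ≤ g), abs_sub_comm T s]
      have i1 : 2 * (A * B) * |s - T| ≤ 2 * 1 * ε := by gcongr
      have i2 : g * |s ^ 2 - T ^ 2| ≤ 1 * (2 * ε) := by
        gcongr
        linarith
      linarith
    have e3 : |G - g| * m ≤ (η ^ 2 / 4) * m := by
      have : |G - g| * m ≤ |G - g| * (1 - s ^ 2) := by gcongr
      linarith
    exact le_of_mul_le_mul_right e3 hm
  have hGg' := abs_le.1 hGg
  set q := Real.sqrt (1 - g) with hq
  have hq2 : q ^ 2 = 1 - g := Real.sq_sqrt (by linarith)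
  have hqκ : Real.sqrt κ' ≤ q := Real.sqrt_le_sqrt (by linarith)
  have hq0 : 0 < q := lt_of_lt_of_le (Real.sqrt_pos.2 hκ') hqκ
  have hq1 : q ≤ 1 := Real.sqrt_le_iff.2 ⟨zero_le_one, by rw [one_pow]; linarith⟩
  have hηq : η * (Q + 1) ≤ (Q - 1) * q :=
    hηQ.trans (mul_le_mul_of_nonneg_left hqκ (by linarith))
  have hηltq : η < q := by
    have h1 : η * (Q + 1) < q * (Q + 1) := by linarith
    exact lt_of_mul_lt_mul_right h1 (by linarith)
  have hη2q2 : η ^ 2 < q ^ 2 := by gcongr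
  have hη2p : 0 < η ^ 2 := by positivity
  set ρ := Real.sqrt (1 - G) with hρ
  have hG1 : 0 < 1 - G := by linarith [hGg'.2]
  have hρ2 : ρ ^ 2 = 1 - G := Real.sq_sqrt hG1.le
  have hρ0 : 0 < ρ := Real.sqrt_pos.2 hG1
  have hQ0 : 0 < Q := by linarith
  constructor
  · set K := 2 * (2 * (4 / m) + 3) with hK
    have h4m : 0 < 4 / m := by positivity
    have hK0 : 6 ≤ K := by linarith
    have hK1 : 0 < K := by linarith
    have hKt : K * (ε / K) = ε := by field_simp
    have ht0 : 0 < ε / K := by positivity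
    have htε : (2 * (4 / m) + 2) * (ε / K) ≤ ε := by
      calc _ ≤ K * (ε / K) := by gcongr; linarith
        _ = ε := hKt
    have low := lower hd hη0 (by linarith) hσ hx1 hy1 (A := A) (B := B) (a := a) (b := b)
      (C := 4 / m) (ε := ε) (ρ := ρ) (t := ε / K) (by rwa [abs_of_nonneg hA0])
      (by rwa [abs_of_nonneg hB0]) hx hy hab hρ0 hρ2 ht0 ((div_le_one hK1).2 (by linarith)) (by linarith)
      (by linarith) hKt.le (by
        apply sqrt_pow_small
        rw [div_pow, ← mul_div_assoc, le_div_iff₀ (by positivity)]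
        exact hbig)
    have hqρ : q ≤ ρ + η := by
      apply le_of_sq_le_sq _ (by positivity)
      rw [add_sq]
      linarith [mul_pos hρ0 hη0, hGg'.2]
    have hstep : (1 + η) * q ≤ Q * ρ := by
      have i1 : Q * q ≤ Q * (ρ + η) := by gcongr
      have i2 : η * q ≤ η * 1 := by gcongr
      linarith
    have hpow : (1 + η) ^ d * q ^ d ≤ Q ^ d * ρ ^ d := by
      rw [← mul_pow, ← mul_pow]
      gcongr
    set S := (σ (wedge x y A B ε)).toReal
    have hS : 0 ≤ S := ENNReal.toReal_nonneg
    have h1 : (1 + η) ^ d * q ^ d ≤ (1 + η) ^ d * (Q ^ d * Q ^ d * S) := by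
      calc _ ≤ Q ^ d * ρ ^ d := hpow
        _ ≤ Q ^ d * (2 * (1 + η) ^ d * S) := by gcongr
        _ ≤ Q ^ d * (Q ^ d * (1 + η) ^ d * S) := by gcongr
        _ = _ := by ring
    have h2 := le_of_mul_le_mul_left h1 (by positivity)
    calc _ ≤ _ := h2
      _ = _ := by ring
  · have up := upper hd hη0 (by linarith) hσ (A := A) (B := B) (a := a) (b := b) (C := 4 / m)
      (ε := ε) (R := q + η) hε0.le hx hy hab hηd (by positivity) (by
        have : 2 * (4 / m) * ε ≤ η ^ 2 / 2 := by
          calc 2 * (4 / m) * ε ≤ 2 * (4 / m) * (m * η ^ 2 / 16) := by gcongr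
            _ = _ := by field_simp; ring
        rw [add_sq]
        linarith [mul_pos hq0 hη0, hGg'.1])
    refine up.trans ?_
    have : η + (q + η) ≤ Q * q := by
      have i1 : η * 2 ≤ η * (Q + 1) := by gcongr; linarith
      linarith
    calc 2 * (η + (q + η)) ^ d ≤ Q ^ d * (Q * q) ^ d := by gcongr
      _ = _ := by rw [mul_pow]; ring

end Wedge

/-- Approximate spherical-wedge volume: for `α, β, θ ∈ [κ, π/2 − κ]` with
`γ² = (cos²α + cos²β − 2cos α cos β cos θ)/sin²θ ∈ [κ′, 1 − κ′]`, and for unit vectors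
`x, y` with `|⟨x,y⟩ − cos θ| ≤ 1/log₂²(d)`, the measure of the approximate wedge is
`(1 − γ²)^{d/2}` up to a factor `2^{±cd}`, for every `c > 0` and `d` large enough. -/
theorem approx_wedge_volume (κ : ℝ) (hκ : κ ∈ Set.Ioo (0 : ℝ) (Real.pi / 4))
    (κ' : ℝ) (hκ' : 0 < κ') (c : ℝ) (hc : 0 < c) :
    ∃ D : ℕ, ∀ d : ℕ, D ≤ d →
      ∀ α ∈ Set.Icc κ (Real.pi / 2 - κ), ∀ β ∈ Set.Icc κ (Real.pi / 2 - κ),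
      ∀ θ ∈ Set.Icc κ (Real.pi / 2 - κ),
      ∀ γsq : ℝ,
        γsq = (Real.cos α ^ 2 + Real.cos β ^ 2 -
            2 * Real.cos α * Real.cos β * Real.cos θ) / Real.sin θ ^ 2 →
        κ' ≤ γsq → γsq ≤ 1 - κ' →
      ∀ σ : Measure (EuclideanSpace ℝ (Fin d)), IsUniformSphereMeasure d σ →
      ∀ x y : EuclideanSpace ℝ (Fin d), ‖x‖ = 1 → ‖y‖ = 1 →
        |⟪x, y⟫ - Real.cos θ| ≤ ((Real.logb 2 d) ^ 2)⁻¹ →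
        (2 : ℝ) ^ (-(c * d)) * (1 - γsq) ^ ((d : ℝ) / 2) ≤
            (σ {w | ‖w‖ = 1 ∧ |⟪x, w⟫ - Real.cos α| ≤ ((Real.logb 2 d) ^ 2)⁻¹ ∧
              |⟪y, w⟫ - Real.cos β| ≤ ((Real.logb 2 d) ^ 2)⁻¹}).toReal ∧
          (σ {w | ‖w‖ = 1 ∧ |⟪x, w⟫ - Real.cos α| ≤ ((Real.logb 2 d) ^ 2)⁻¹ ∧
              |⟪y, w⟫ - Real.cos β| ≤ ((Real.logb 2 d) ^ 2)⁻¹}).toReal ≤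
            (2 : ℝ) ^ (c * d) * (1 - γsq) ^ ((d : ℝ) / 2) := by
  obtain ⟨hκ0, hκ1⟩ := hκ
  have hpi := Real.pi_pos
  set m : ℝ := Real.sin κ ^ 2 / 2 with hm
  have hsκ : 0 < Real.sin κ := Real.sin_pos_of_pos_of_lt_pi hκ0 (by linarith)
  have hm0 : 0 < m := by positivity
  have hm1 : m ≤ 1 / 2 := by
    have := Real.sin_sq_le_one κ
    linarith
  set Q : ℝ := (2 : ℝ) ^ (c / 2) with hQ
  have hQ1 : 1 < Q := Real.one_lt_rpow one_lt_two (by positivity)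
  have hsq : 0 < Real.sqrt κ' := Real.sqrt_pos.2 hκ'
  set η : ℝ := min (1 / 2) ((Q - 1) * Real.sqrt κ' / (Q + 1)) with hη
  have hη0 : 0 < η := lt_min (by norm_num)
    (div_pos (mul_pos (by linarith) hsq) (by linarith))
  have hη1 : η ≤ 1 / 2 := min_le_left _ _
  have hηQ : η * (Q + 1) ≤ (Q - 1) * Real.sqrt κ' := by
    rw [← le_div_iff₀ (by linarith)]
    exact min_le_right _ _
  have E1 := Wedge.ev_eps.eventually (ge_mem_nhds (show (0 : ℝ) < m * η ^ 2 / 16 by positivity))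
  have E2 := Wedge.ev_big (20 * (2 * (2 * (4 / m) + 3)) ^ 2)
  have E3 := (tendsto_pow_atTop_nhds_zero_of_lt_one (show (0 : ℝ) ≤ 1 - η by linarith)
    (show 1 - η < 1 by linarith)).eventually (ge_mem_nhds (show (0 : ℝ) < 1 / 2 by norm_num))
  have E4 := (tendsto_pow_atTop_atTop_of_one_lt hQ1).eventually (Filter.eventually_ge_atTop 2)
  obtain ⟨D, hD⟩ := Filter.eventually_atTop.1
    (E1.and (E2.and (E3.and (E4.and (Filter.eventually_ge_atTop 2)))))
  refine ⟨D, fun d hdD α hα β hβ θ hθ g hg hg0 hg1 σ hσ x y hx hy hxy => ?_⟩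
  obtain ⟨e1, e2, e3, e4, e5⟩ := hD d hdD
  have hd2 : (2 : ℝ) ≤ d := by exact_mod_cast e5
  have hL : 0 < Real.logb 2 d := Real.logb_pos one_lt_two (by linarith)
  have hcos : ∀ φ ∈ Set.Icc κ (Real.pi / 2 - κ), 0 ≤ Real.cos φ := fun φ hφ =>
    Real.cos_nonneg_of_mem_Icc ⟨by linarith [hφ.1], by linarith [hφ.2]⟩
  have hsinθ : Real.sin κ ≤ Real.sin θ :=
    Real.sin_le_sin_of_le_of_le_pi_div_two (by linarith) (by linarith [hθ.2]) hθ.1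
  have hsθ : 0 < Real.sin θ := by linarith
  have hcs : 1 - Real.cos θ ^ 2 = Real.sin θ ^ 2 := by
    linarith [Real.sin_sq_add_cos_sq θ]
  have core := Wedge.core (by omega : d ≠ 0) hσ hx hy (A := Real.cos α) (B := Real.cos β)
    (T := Real.cos θ) (m := m) (g := g) (ε := ((Real.logb 2 d) ^ 2)⁻¹) (η := η) (κ' := κ') (Q := Q)
    (hcos α hα) (Real.cos_le_one _) (hcos β hβ) (Real.cos_le_one _) (hcos θ hθ)
    (Real.cos_le_one _) hm0 hm1 (by rw [hcs, hm]; nlinarith)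
    (by rw [hcs, hg]; field_simp) hκ' hg0 hg1 hη0 hη1 hQ1 hηQ (by positivity) e1 e2 e3 e4 hxy
  have hg2 : (1 - g) ^ ((d : ℝ) / 2) = Real.sqrt (1 - g) ^ d := by
    rw [Real.sqrt_eq_rpow, ← Real.rpow_natCast, ← Real.rpow_mul (by linarith)]
    congr 1
    ring
  have hQ2 : (2 : ℝ) ^ (c * d) = (Q ^ 2) ^ d := by
    rw [hQ, ← pow_mul, ← Real.rpow_natCast, ← Real.rpow_mul (by norm_num)]
    congr 1
    push_cast
    ring
  rw [Real.rpow_neg (by norm_num), hg2, hQ2]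
  refine ⟨?_, core.2⟩
  rw [inv_mul_le_iff₀ (by positivity)]
  exact core.1
end

section
/- For each integer d ≥ 2 set ε_d := (log₂ d)^{−2} and c′_d := ε_d + √(1/3 + ε_d/2), and define p_d := (σ_d ⊗ σ_d)({(x, y) ∈ S^{d−1} × S^{d−1} : |⟨x, y⟩ − 1/3| ≤ ε_d}) and p′_d := σ_d({z ∈ S^{d−1} : |⟨z, e₁⟩ − c′_d| ≤ ε_d}), where e₁ is the first standard basis vector of ℝ^d. Then lim_{d→∞} −(1/d)·log₂(p_d · p′_d) = (1/2)·log₂(27/16). -/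
open MeasureTheory
open scoped RealInnerProductSpace

lemma exists_iso {d : ℕ} (v w : EuclideanSpace ℝ (Fin d)) (h : ‖v‖ = ‖w‖) :
    ∃ O : EuclideanSpace ℝ (Fin d) ≃ₗᵢ[ℝ] EuclideanSpace ℝ (Fin d), O v = w :=
  ⟨_, Submodule.reflection_sub h⟩

lemma meas_cap {d : ℕ} (σ : Measure (EuclideanSpace ℝ (Fin d)))
    (hinv : ∀ O : EuclideanSpace ℝ (Fin d) ≃ₗᵢ[ℝ] EuclideanSpace ℝ (Fin d), Measure.map (⇑O) σ = σ)
    (p : ℝ → ℝ → Prop) (hp : MeasurableSet {q : ℝ × ℝ | p q.1 q.2})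
    (v w : EuclideanSpace ℝ (Fin d)) (h : ‖v‖ = ‖w‖) :
    σ {z | p ‖z‖ ⟪z, v⟫} = σ {z | p ‖z‖ ⟪z, w⟫} := by
  obtain ⟨O, hO⟩ := exists_iso v w h
  have hm : MeasurableSet {z : EuclideanSpace ℝ (Fin d) | p ‖z‖ ⟪z, w⟫} := by
    have : Measurable (fun z : EuclideanSpace ℝ (Fin d) => (‖z‖, ⟪z, w⟫)) := by fun_prop
    exact this hp
  conv_rhs => rw [← hinv O]
  rw [Measure.map_apply O.continuous.measurable hm]
  congr 1
  ext z
  simp only [Set.mem_ofPred_eq, Set.mem_preimage, O.norm_map]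
  rw [← hO, O.inner_map_map]

lemma transfer {d : ℕ} (σ : Measure (EuclideanSpace ℝ (Fin d)))
    (hσ : IsUniformSphereMeasure d σ) (a : ℝ) (e : EuclideanSpace ℝ (Fin d)) (he : ‖e‖ = 1) :
    σ {z | ‖z‖ = 1 ∧ a ≤ ⟪z, e⟫} * volume (Metric.closedBall (0 : EuclideanSpace ℝ (Fin d)) 1) =
      volume {y : EuclideanSpace ℝ (Fin d) | ‖y‖ ≤ 1 ∧ a * ‖y‖ ≤ ⟪y, e⟫} := by
  obtain ⟨hprob, hsph, hinv⟩ := hσ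
  have : Nontrivial (EuclideanSpace ℝ (Fin d)) := ⟨e, 0, by rintro rfl; simp at he⟩
  set V := (volume : Measure (EuclideanSpace ℝ (Fin d))).restrict (Metric.closedBall 0 1) with hV
  let S : Set (EuclideanSpace ℝ (Fin d) × EuclideanSpace ℝ (Fin d)) :=
    {q | ‖q.1‖ = 1 ∧ a * ‖q.2‖ ≤ ⟪q.1, q.2⟫}
  have hS : MeasurableSet S := by
    have h1 : IsClosed S := by
      have c1 : IsClosed {q : EuclideanSpace ℝ (Fin d) × EuclideanSpace ℝ (Fin d) | ‖q.1‖ = 1} :=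
        isClosed_eq (by fun_prop) (by fun_prop)
      have c2 : IsClosed {q : EuclideanSpace ℝ (Fin d) × EuclideanSpace ℝ (Fin d) |
          a * ‖q.2‖ ≤ ⟪q.1, q.2⟫} := isClosed_le (by fun_prop) (by fun_prop)
      exact c1.inter c2
    exact h1.measurableSet
  have A1 := Measure.prod_apply (μ := σ) (ν := V) hS
  have A2 := Measure.prod_apply_symm (μ := σ) (ν := V) hS
  have hb1 : ∀ᵐ z ∂σ, ‖z‖ = 1 := by
    have := (prob_compl_eq_zero_iff (μ := σ) (Metric.isClosed_sphere (x := (0 : EuclideanSpace ℝ (Fin d))) (ε := 1)).measurableSet).2 hsph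
    rw [ae_iff]
    convert this using 2
    ext z; simp
  have B1 : ∫⁻ z, V (Prod.mk z ⁻¹' S) ∂σ =
      volume {y : EuclideanSpace ℝ (Fin d) | ‖y‖ ≤ 1 ∧ a * ‖y‖ ≤ ⟪y, e⟫} := by
    rw [lintegral_congr_ae (g := fun _ => volume {y : EuclideanSpace ℝ (Fin d) | ‖y‖ ≤ 1 ∧ a * ‖y‖ ≤ ⟪y, e⟫})]
    · simp
    filter_upwards [hb1] with z hz
    rw [hV, Measure.restrict_apply (measurable_prodMk_left hS)]
    rw [← meas_cap volume (fun O => O.measurePreserving.map_eq) (fun s t => s ≤ 1 ∧ a * s ≤ t) ?_ z e (by rw [hz, he])]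
    · congr 1
      ext y
      simp [S, hz, real_inner_comm, and_comm]
    · have c1 : MeasurableSet {q : ℝ × ℝ | q.1 ≤ 1} := measurableSet_le (by fun_prop) (by fun_prop)
      have c2 : MeasurableSet {q : ℝ × ℝ | a * q.1 ≤ q.2} :=
        measurableSet_le (by fun_prop) (by fun_prop)
      exact c1.inter c2
  have hb2 : ∀ᵐ y ∂V, y ≠ 0 := by
    rw [hV]
    apply ae_restrict_of_ae
    rw [ae_iff]; simp
  have B2 : ∫⁻ y, σ ((fun x => (x, y)) ⁻¹' S) ∂V =
      σ {z | ‖z‖ = 1 ∧ a ≤ ⟪z, e⟫} * volume (Metric.closedBall (0 : EuclideanSpace ℝ (Fin d)) 1) := by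
    rw [lintegral_congr_ae (g := fun _ => σ {z | ‖z‖ = 1 ∧ a ≤ ⟪z, e⟫})]
    · simp [hV]
    filter_upwards [hb2] with y hy
    have hy' : 0 < ‖y‖ := norm_pos_iff.2 hy
    rw [← meas_cap σ hinv (fun s t => s = 1 ∧ a ≤ t) ?_ (‖y‖⁻¹ • y) e (by rw [he, norm_smul, norm_inv, norm_norm, inv_mul_cancel₀ hy'.ne'])]
    · congr 1
      ext z
      simp only [S, Set.mem_preimage, Set.mem_ofPred_eq, inner_smul_right]
      rw [le_inv_mul_iff₀ hy', mul_comm]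
    · have c1 : MeasurableSet {q : ℝ × ℝ | q.1 = 1} :=
        measurableSet_eq_fun (by fun_prop) (by fun_prop)
      have c2 : MeasurableSet {q : ℝ × ℝ | a ≤ q.2} := measurableSet_le (by fun_prop) (by fun_prop)
      exact c1.inter c2
  rw [← B1, ← B2, ← A1, ← A2]

lemma cone_upper {d : ℕ} (a : ℝ) (ha0 : 0 ≤ a) (ha : a ^ 2 ≤ 1 / 2)
    (e : EuclideanSpace ℝ (Fin d)) (he : ‖e‖ = 1) :
    volume {y : EuclideanSpace ℝ (Fin d) | ‖y‖ ≤ 1 ∧ a * ‖y‖ ≤ ⟪y, e⟫} ≤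
      ENNReal.ofReal (√(1 - a ^ 2) ^ d) * volume (Metric.closedBall (0 : EuclideanSpace ℝ (Fin d)) 1) := by
  have h := Measure.addHaar_closedBall' (volume : Measure (EuclideanSpace ℝ (Fin d))) (a • e) (Real.sqrt_nonneg (1 - a ^ 2))
  rw [finrank_euclideanSpace, Fintype.card_fin] at h
  rw [← h]
  apply measure_mono
  rintro y ⟨h1, h2⟩
  rw [mem_closedBall_iff_norm]
  apply Real.le_sqrt_of_sq_le
  rw [norm_sub_sq_real, inner_smul_right, norm_smul, he, Real.norm_of_nonneg ha0]
  have := norm_nonneg y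
  nlinarith [mul_nonneg ha0 (sub_nonneg.2 h2), mul_nonneg this (sub_nonneg.2 h1)]

lemma slab_lower {d : ℕ} (hd : 0 < d) (R : ℝ) (hR : R ≤ 1)
    (e : EuclideanSpace ℝ (Fin d)) (he : ‖e‖ = 1) :
    volume (Metric.closedBall (0 : EuclideanSpace ℝ (Fin d)) R) ≤
     2 * ((d + 1 : ℕ) * volume {u : EuclideanSpace ℝ (Fin d) | ‖u‖ ≤ R ∧ 0 ≤ ⟪u, e⟫ ∧ ⟪u, e⟫ ≤ 1 / d}) := by
  set S := {u : EuclideanSpace ℝ (Fin d) | ‖u‖ ≤ R ∧ 0 ≤ ⟪u, e⟫ ∧ ⟪u, e⟫ ≤ 1 / d} with hS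
  set H := {u : EuclideanSpace ℝ (Fin d) | ‖u‖ ≤ R ∧ 0 ≤ ⟪u, e⟫} with hH
  have hdp : (0 : ℝ) < d := by exact_mod_cast hd
  have h1 : volume (Metric.closedBall (0 : EuclideanSpace ℝ (Fin d)) R) ≤ 2 * volume H := by
    have : Metric.closedBall (0 : EuclideanSpace ℝ (Fin d)) R ⊆ H ∪ -H := by
      intro u hu
      rw [mem_closedBall_zero_iff] at hu
      rcases le_total 0 ⟪u, e⟫ with h | h
      · exact Or.inl ⟨hu, h⟩
      · right
        simp [hH, hu, inner_neg_left, h]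
    calc _ ≤ volume (H ∪ -H) := measure_mono this
      _ ≤ volume H + volume (-H) := measure_union_le _ _
      _ = 2 * volume H := by rw [Measure.measure_neg, two_mul]
  refine h1.trans ?_
  gcongr
  have h2 : H ⊆ ⋃ k ∈ Finset.range (d + 1),
      (fun u => (-((k : ℝ) / d)) • e + u) ⁻¹' S := by
    rintro u ⟨hu1, hu2⟩
    have hle : ⟪u, e⟫ ≤ 1 := by
      have := real_inner_le_norm u e
      rw [he, mul_one] at this
      linarith
    have hf1 : (⌊(d : ℝ) * ⟪u, e⟫⌋₊ : ℝ) ≤ d * ⟪u, e⟫ := Nat.floor_le (by positivity)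
    have hf2 : d * ⟪u, e⟫ < (⌊(d : ℝ) * ⟪u, e⟫⌋₊ : ℝ) + 1 := Nat.lt_floor_add_one _
    simp only [Set.mem_iUnion]
    refine ⟨⌊(d : ℝ) * ⟪u, e⟫⌋₊, ?_, ?_⟩
    · rw [Finset.mem_range, Nat.lt_succ_iff]
      have : (⌊(d : ℝ) * ⟪u, e⟫⌋₊ : ℝ) ≤ d := by nlinarith
      exact_mod_cast this
    · set k : ℝ := (⌊(d : ℝ) * ⟪u, e⟫⌋₊ : ℝ)
      have hk0 : 0 ≤ k := by positivity
      have hkd : k / d ≤ ⟪u, e⟫ := by rw [div_le_iff₀ hdp]; linarith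
      have hkd0 : 0 ≤ k / d := by positivity
      have hkd2 : ⟪u, e⟫ ≤ k / d + 1 / d := by rw [← add_div, le_div_iff₀ hdp]; linarith
      have hee : ⟪e, e⟫ = 1 := by rw [real_inner_self_eq_norm_sq, he]; norm_num
      simp only [Set.mem_preimage, hS, Set.mem_ofPred_eq, inner_add_left, inner_smul_left, hee]
      refine ⟨?_, by simp; linarith, by simp; simp at hkd2; linarith⟩
      refine le_trans ?_ hu1
      rw [← sq_le_sq₀ (norm_nonneg _) (norm_nonneg _), norm_add_sq_real, inner_smul_left, norm_smul, he, real_inner_comm]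
      simp only [Real.norm_eq_abs, mul_one, sq_abs]
      simp
      nlinarith
  calc volume H ≤ _ := measure_mono h2
    _ ≤ ∑ k ∈ Finset.range (d + 1), volume ((fun u => (-((k : ℝ) / d)) • e + u) ⁻¹' S) := measure_biUnion_finset_le _ _
    _ = _ := by simp [measure_preimage_add]

open scoped Pointwise in
lemma cone_lower {d : ℕ} (hd : 0 < d) (a : ℝ) (ha0 : 0 ≤ a) (ha : a ≤ 1)
    (e : EuclideanSpace ℝ (Fin d)) (he : ‖e‖ = 1) :
    ENNReal.ofReal (√(1 - a ^ 2) ^ d) * volume (Metric.closedBall (0 : EuclideanSpace ℝ (Fin d)) 1) ≤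
     2 * ((d + 1 : ℕ) * (ENNReal.ofReal (Real.exp 1) *
      volume {y : EuclideanSpace ℝ (Fin d) | ‖y‖ ≤ 1 ∧ a * ‖y‖ ≤ ⟪y, e⟫})) := by
  have h := Measure.addHaar_closedBall' (volume : Measure (EuclideanSpace ℝ (Fin d))) 0 (Real.sqrt_nonneg (1 - a ^ 2))
  rw [finrank_euclideanSpace, Fintype.card_fin] at h
  rw [← h]
  have hR : √(1 - a ^ 2) ≤ 1 := Real.sqrt_le_one.2 (by nlinarith)
  refine (slab_lower hd _ hR e he).trans ?_
  have hdp : (0 : ℝ) < d := by exact_mod_cast hd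
  gcongr
  set C := {y : EuclideanSpace ℝ (Fin d) | ‖y‖ ≤ 1 ∧ a * ‖y‖ ≤ ⟪y, e⟫} with hC
  set S := {u : EuclideanSpace ℝ (Fin d) | ‖u‖ ≤ √(1 - a ^ 2) ∧ 0 ≤ ⟪u, e⟫ ∧ ⟪u, e⟫ ≤ 1 / d} with hS
  have hs := Measure.addHaar_smul (volume : Measure (EuclideanSpace ℝ (Fin d))) (Real.exp (1 / d)) C
  rw [finrank_euclideanSpace, Fintype.card_fin, abs_of_pos (by positivity), ← Real.exp_nat_mul, mul_one_div_cancel hdp.ne'] at hs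
  rw [← hs]
  have : S ⊆ (fun u => a • e + u) ⁻¹' (Real.exp (1 / d) • C) := by
    rintro u ⟨h1, h2, h3⟩
    rw [Set.mem_preimage, Set.mem_smul_set_iff_inv_smul_mem₀ (by positivity)]
    have hee : ⟪e, e⟫ = 1 := by rw [real_inner_self_eq_norm_sq, he]; norm_num
    have h1' : ‖u‖ ^ 2 ≤ 1 - a ^ 2 := by
      have := pow_le_pow_left₀ (norm_nonneg u) h1 2
      rwa [Real.sq_sqrt (by nlinarith)] at this
    have hn : ‖a • e + u‖ ^ 2 ≤ 1 + 2 * a * ⟪u, e⟫ := by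
      rw [norm_add_sq_real, inner_smul_left, norm_smul, he, real_inner_comm]
      simp only [Real.norm_eq_abs, mul_one, sq_abs]
      simp
      nlinarith
    have hE : 1 + 2 * (1 / (d : ℝ)) ≤ Real.exp (1 / d) ^ 2 := by
      rw [← Real.exp_nat_mul]
      have := Real.add_one_le_exp (((2 : ℕ) : ℝ) * (1 / d))
      push_cast at this ⊢
      linarith
    have hin : ⟪a • e + u, e⟫ = a + ⟪u, e⟫ := by
      rw [inner_add_left, inner_smul_left, hee]; simp
    have hpos : 0 < Real.exp (1 / d) := by positivity
    simp only [hC, Set.mem_ofPred_eq, norm_smul, inner_smul_left, hin, norm_inv, Real.norm_of_nonneg hpos.le]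
    constructor
    · rw [inv_mul_le_iff₀ hpos, mul_one, ← sq_le_sq₀ (norm_nonneg _) hpos.le]
      nlinarith [mul_nonneg (sub_nonneg.2 ha) h2]
    · have : a * ‖a • e + u‖ ≤ a + ⟪u, e⟫ := by
        rw [← sq_le_sq₀ (by positivity) (by positivity), mul_pow]
        have := mul_le_mul_of_nonneg_left hn (sq_nonneg a)
        have h5 : a ^ 2 * (a * ⟪u, e⟫) ≤ 1 * (a * ⟪u, e⟫) := 
          mul_le_mul_of_nonneg_right (by nlinarith) (by positivity)
        nlinarith
      simp only [conj_trivial]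
      calc _ = (Real.exp (1 / d))⁻¹ * (a * ‖a • e + u‖) := by ring
        _ ≤ _ := by gcongr
  calc volume S ≤ _ := measure_mono this
    _ = _ := measure_preimage_add _ _ _

lemma cap_bounds {d : ℕ} (hd : 2 ≤ d) (σ : Measure (EuclideanSpace ℝ (Fin d)))
    (hσ : IsUniformSphereMeasure d σ) (a : ℝ) (ha0 : 0 ≤ a) (ha : a ^ 2 ≤ 1 / 2)
    (e : EuclideanSpace ℝ (Fin d)) (he : ‖e‖ = 1) :
    (σ {z | ‖z‖ = 1 ∧ a ≤ ⟪z, e⟫}).toReal ≤ √(1 - a ^ 2) ^ d ∧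
    √(1 - a ^ 2) ^ d ≤ 2 * ((d + 1) * (Real.exp 1 * (σ {z | ‖z‖ = 1 ∧ a ≤ ⟪z, e⟫}).toReal)) := by
  have hprob := hσ.1
  have hV0 : volume (Metric.closedBall (0 : EuclideanSpace ℝ (Fin d)) 1) ≠ 0 :=
    (Metric.measure_closedBall_pos _ _ one_pos).ne'
  have hV1 : volume (Metric.closedBall (0 : EuclideanSpace ℝ (Fin d)) 1) ≠ ⊤ :=
    measure_closedBall_lt_top.ne
  have hu := cone_upper a ha0 ha e he
  have hl := cone_lower (by omega : 0 < d) a ha0 (by nlinarith) e he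
  rw [← transfer σ hσ a e he] at hu hl
  rw [ENNReal.mul_le_mul_iff_left hV0 hV1] at hu
  rw [← mul_assoc, ← mul_assoc, ← mul_assoc, ENNReal.mul_le_mul_iff_left hV0 hV1] at hl
  constructor
  · exact ENNReal.toReal_le_of_le_ofReal (by positivity) hu
  · rw [ENNReal.ofReal_le_iff_le_toReal] at hl
    · refine hl.trans (le_of_eq ?_)
      rw [ENNReal.toReal_mul, ENNReal.toReal_mul, ENNReal.toReal_mul, ENNReal.toReal_ofReal (Real.exp_pos 1).le]
      simp only [ENNReal.toReal_ofNat, ENNReal.toReal_natCast]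
      push_cast
      ring
    · refine ENNReal.mul_ne_top (ENNReal.mul_ne_top (ENNReal.mul_ne_top (by simp) (by simp)) (by simp)) (measure_ne_top _ _)

lemma band_bounds {d : ℕ} (hd : 2 ≤ d) (σ : Measure (EuclideanSpace ℝ (Fin d)))
    (hσ : IsUniformSphereMeasure d σ) (a b : ℝ) (ha0 : 0 ≤ a) (hab : a ≤ b) (hb : b ^ 2 ≤ 1 / 2)
    (e : EuclideanSpace ℝ (Fin d)) (he : ‖e‖ = 1) (B : Set (EuclideanSpace ℝ (Fin d)))
    (hB : ∀ z, z ∈ B ↔ ‖z‖ = 1 ∧ a ≤ ⟪z, e⟫ ∧ ⟪z, e⟫ ≤ b) :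
    (σ B).toReal ≤ √(1 - a ^ 2) ^ d ∧
    √(1 - a ^ 2) ^ d ≤ 2 * ((d + 1) * (Real.exp 1 * ((σ B).toReal + √(1 - b ^ 2) ^ d))) := by
  have hprob := hσ.1
  obtain ⟨h1, h2⟩ := cap_bounds hd σ hσ a ha0 (by nlinarith) e he
  obtain ⟨h3, h4⟩ := cap_bounds hd σ hσ b (by linarith) hb e he
  constructor
  · refine le_trans ?_ h1
    apply ENNReal.toReal_mono (measure_ne_top _ _)
    apply measure_mono
    intro z hz
    exact ⟨((hB z).1 hz).1, ((hB z).1 hz).2.1⟩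
  · have h5 : (σ {z | ‖z‖ = 1 ∧ a ≤ ⟪z, e⟫}).toReal ≤ (σ B).toReal + (σ {z | ‖z‖ = 1 ∧ b ≤ ⟪z, e⟫}).toReal := by
      rw [← ENNReal.toReal_add (measure_ne_top _ _) (measure_ne_top _ _)]
      apply ENNReal.toReal_mono (by simp)
      refine le_trans (measure_mono ?_) (measure_union_le _ _)
      rintro z ⟨hz1, hz2⟩
      rcases le_total ⟪z, e⟫ b with h | h
      · exact Or.inl ((hB z).2 ⟨hz1, hz2, h⟩)
      · exact Or.inr ⟨hz1, h⟩
    refine h2.trans ?_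
    have := Real.exp_pos 1
    gcongr
    linarith

lemma eventually_small (α : ℝ) (hα : 0 < α) :
    ∀ᶠ d : ℕ in Filter.atTop,
      4 * Real.exp 1 * ((d : ℝ) + 1) ≤ (d : ℝ) ^ 2 ∧
      (d : ℝ) ^ 2 ≤ Real.exp (α * ((Real.logb 2 d) ^ 2)⁻¹ * d) := by
  have h1 := (Real.isLittleO_pow_log_id_atTop (n := 3)).comp_tendsto tendsto_natCast_atTop_atTop
  have hl2 : 0 < Real.log 2 := Real.log_pos (by norm_num)
  have hc : 0 < α * (Real.log 2) ^ 2 / 2 := by positivity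
  filter_upwards [h1.bound hc, Filter.eventually_ge_atTop 24] with d hd h24
  have h24' : (24 : ℝ) ≤ d := by exact_mod_cast h24
  have hlog : 0 < Real.log d := Real.log_pos (by linarith)
  constructor
  · have := Real.exp_one_lt_d9
    nlinarith
  · simp only [Function.comp, id, Real.norm_eq_abs] at hd
    rw [abs_of_pos (by positivity), abs_of_pos (by linarith)] at hd
    rw [← Real.log_le_iff_le_exp (by positivity), Real.log_pow, Real.logb]
    rw [div_pow, inv_div, mul_div_assoc', div_mul_eq_mul_div, le_div_iff₀ (by positivity)]
    push_cast
    nlinarith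

lemma asymp (a b P : ℕ → ℝ) (α : ℝ) (hα : 0 < α) (hα2 : α ^ 2 < 1 / 2)
    (ha : Filter.Tendsto a Filter.atTop (nhds α)) (hb : Filter.Tendsto b Filter.atTop (nhds α))
    (hab : ∀ d, b d = a d + 2 * ((Real.logb 2 d) ^ 2)⁻¹)
    (hP : ∀ d : ℕ, 2 ≤ d → 0 ≤ a d → a d ≤ b d → b d ^ 2 ≤ 1 / 2 →
      P d ≤ √(1 - a d ^ 2) ^ d ∧
      √(1 - a d ^ 2) ^ d ≤ 2 * ((d + 1) * (Real.exp 1 * (P d + √(1 - b d ^ 2) ^ d)))) :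
    (∀ᶠ d in Filter.atTop, 0 < P d) ∧
    Filter.Tendsto (fun d : ℕ => Real.log (P d) / d) Filter.atTop
      (nhds (Real.log (1 - α ^ 2) / 2)) := by
  have hb2 : ∀ᶠ d in Filter.atTop, b d ^ 2 < 1 / 2 := (hb.pow 2).eventually_lt_const hα2
  have ha2 : ∀ᶠ d in Filter.atTop, α / 2 < a d := ha.eventually_const_lt (by linarith)
  have key : ∀ᶠ d : ℕ in Filter.atTop, 0 < P d ∧
      Real.log (1 - a d ^ 2) / 2 - 2 * (Real.log d / d) ≤ Real.log (P d) / d ∧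
      Real.log (P d) / d ≤ Real.log (1 - a d ^ 2) / 2 := by
    filter_upwards [hb2, ha2, eventually_small α hα, Filter.eventually_ge_atTop 2] with d h1 h2 h3 hd
    have hd' : (2 : ℝ) ≤ d := by exact_mod_cast hd
    have hε : 0 ≤ ((Real.logb 2 d) ^ 2)⁻¹ := by positivity
    have habd : a d ≤ b d := by rw [hab]; linarith
    obtain ⟨hu, hl⟩ := hP d hd (by linarith) habd h1.le
    obtain ⟨h3, h4⟩ := h3
    have hasq : a d ^ 2 ≤ 1 / 2 := by nlinarith
    set E := Real.exp (α * ((Real.logb 2 d) ^ 2)⁻¹ * d) with hE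
    set R := √(1 - a d ^ 2) with hR
    have hRpos : 0 < R := Real.sqrt_pos.2 (by linarith)
    have hRb : √(1 - b d ^ 2) ≤ R * Real.exp (-(α * ((Real.logb 2 d) ^ 2)⁻¹)) := by
      rw [Real.sqrt_le_left (by positivity), mul_pow, hR, Real.sq_sqrt (by linarith),
        ← Real.exp_nat_mul]
      have hx : 2 * (α * ((Real.logb 2 d) ^ 2)⁻¹) ≤ b d ^ 2 - a d ^ 2 := by
        rw [hab]; nlinarith
      have hy := Real.add_one_le_exp (((2 : ℕ) : ℝ) * -(α * ((Real.logb 2 d) ^ 2)⁻¹))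
      push_cast at hy ⊢
      have hz : 0 ≤ α * ((Real.logb 2 d) ^ 2)⁻¹ := by positivity
      calc 1 - b d ^ 2 ≤ (1 - a d ^ 2) * (1 - 2 * (α * ((Real.logb 2 d) ^ 2)⁻¹)) := by
            nlinarith [mul_nonneg (sq_nonneg (a d)) hz]
        _ ≤ _ := by
            apply mul_le_mul_of_nonneg_left _ (by linarith)
            linarith
    have hRbd : √(1 - b d ^ 2) ^ d ≤ R ^ d * E⁻¹ := by
      refine (pow_le_pow_left₀ (Real.sqrt_nonneg _) hRb d).trans (le_of_eq ?_)
      rw [mul_pow, ← Real.exp_nat_mul, hE, ← Real.exp_neg]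
      congr 2
      ring
    have hEpos : 0 < E := Real.exp_pos _
    have hRd : 0 < R ^ d := by positivity
    have he := Real.exp_pos 1
    have hPl : R ^ d / (d : ℝ) ^ 2 ≤ P d := by
      set K := 2 * Real.exp 1 * ((d : ℝ) + 1) with hK
      have hKpos : 0 < K := by positivity
      have h5 : R ^ d ≤ K * P d + K * (R ^ d * E⁻¹) := by
        calc _ ≤ _ := hl
          _ = K * P d + K * √(1 - b d ^ 2) ^ d := by rw [hK]; ring
          _ ≤ _ := by gcongr
      have h6 : K * (R ^ d * E⁻¹) ≤ R ^ d / 2 := by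
        have : K * E⁻¹ ≤ 1 / 2 := by
          rw [← div_eq_mul_inv, div_le_iff₀ hEpos]; linarith
        nlinarith
      have h7 : R ^ d ≤ 2 * K * P d := by linarith
      have hPpos : 0 < P d := by
        by_contra hneg
        push Not at hneg
        nlinarith
      rw [div_le_iff₀ (by positivity)]
      nlinarith
    have hPpos : 0 < P d := lt_of_lt_of_le (by positivity) hPl
    have hlogR : Real.log (R ^ d) = d * (Real.log (1 - a d ^ 2) / 2) := by
      rw [Real.log_pow, hR, Real.log_sqrt (by linarith)]
    refine ⟨hPpos, ?_, ?_⟩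
    · have := Real.log_le_log (by positivity) hPl
      rw [Real.log_div (by positivity) (by positivity), hlogR, Real.log_pow] at this
      rw [le_div_iff₀ (by positivity)]
      push_cast at this
      refine le_trans (le_of_eq ?_) this
      field_simp
    · have := Real.log_le_log hPpos hu
      rw [hlogR] at this
      rw [div_le_iff₀ (by positivity)]
      linarith
  refine ⟨key.mono fun d h => h.1, ?_⟩
  have ht : Filter.Tendsto (fun d => Real.log (1 - a d ^ 2) / 2) Filter.atTop
      (nhds (Real.log (1 - α ^ 2) / 2)) :=
    (((ha.pow 2).const_sub 1).log (by linarith)).div_const 2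
  have hlogd : Filter.Tendsto (fun d : ℕ => Real.log d / d) Filter.atTop (nhds 0) :=
    (Real.isLittleO_log_id_atTop.tendsto_div_nhds_zero).comp tendsto_natCast_atTop_atTop
  have ht' : Filter.Tendsto (fun d : ℕ => Real.log (1 - a d ^ 2) / 2 - 2 * (Real.log d / d)) Filter.atTop
      (nhds (Real.log (1 - α ^ 2) / 2)) := by
    simpa using ht.sub (hlogd.const_mul 2)
  exact tendsto_of_tendsto_of_tendsto_of_le_of_le' ht' ht (key.mono fun d h => h.2.1)
    (key.mono fun d h => h.2.2)

lemma prod_eq {d : ℕ} (σ : Measure (EuclideanSpace ℝ (Fin d)))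
    (hσ : IsUniformSphereMeasure d σ) (ε : ℝ) (e : EuclideanSpace ℝ (Fin d)) (he : ‖e‖ = 1) :
    (σ.prod σ) {q : EuclideanSpace ℝ (Fin d) × EuclideanSpace ℝ (Fin d) |
            ‖q.1‖ = 1 ∧ ‖q.2‖ = 1 ∧ |⟪q.1, q.2⟫ - 1 / 3| ≤ ε} =
      σ {z | ‖z‖ = 1 ∧ |⟪z, e⟫ - 1 / 3| ≤ ε} := by
  obtain ⟨hprob, hsph, hinv⟩ := hσ
  have hb1 : ∀ᵐ z ∂σ, ‖z‖ = 1 := by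
    have := (prob_compl_eq_zero_iff (μ := σ) (Metric.isClosed_sphere (x := (0 : EuclideanSpace ℝ (Fin d))) (ε := 1)).measurableSet).2 hsph
    rw [ae_iff]
    convert this using 2
    ext z; simp
  have hS : MeasurableSet {q : EuclideanSpace ℝ (Fin d) × EuclideanSpace ℝ (Fin d) |
            ‖q.1‖ = 1 ∧ ‖q.2‖ = 1 ∧ |⟪q.1, q.2⟫ - 1 / 3| ≤ ε} := by
    have c1 : IsClosed {q : EuclideanSpace ℝ (Fin d) × EuclideanSpace ℝ (Fin d) | ‖q.1‖ = 1} :=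
      isClosed_eq (by fun_prop) (by fun_prop)
    have c2 : IsClosed {q : EuclideanSpace ℝ (Fin d) × EuclideanSpace ℝ (Fin d) | ‖q.2‖ = 1} :=
      isClosed_eq (by fun_prop) (by fun_prop)
    have c3 : IsClosed {q : EuclideanSpace ℝ (Fin d) × EuclideanSpace ℝ (Fin d) |
        |⟪q.1, q.2⟫ - 1 / 3| ≤ ε} := isClosed_le (by fun_prop) (by fun_prop)
    exact (c1.inter (c2.inter c3)).measurableSet
  rw [Measure.prod_apply hS,
    lintegral_congr_ae (g := fun _ => σ {z | ‖z‖ = 1 ∧ |⟪z, e⟫ - 1 / 3| ≤ ε})]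
  · simp
  filter_upwards [hb1] with z hz
  rw [← meas_cap σ hinv (fun s t => s = 1 ∧ |t - 1 / 3| ≤ ε) ?_ z e (by rw [hz, he])]
  · congr 1
    ext y
    simp [hz, real_inner_comm]
  · have c1 : IsClosed {q : ℝ × ℝ | q.1 = 1} := isClosed_eq (by fun_prop) (by fun_prop)
    have c2 : IsClosed {q : ℝ × ℝ | |q.2 - 1 / 3| ≤ ε} := isClosed_le (by fun_prop) (by fun_prop)
    exact (c1.inter c2).measurableSet

lemma final_alg (x y t : ℝ) (hx : 0 < x) (hy : 0 < y) :
    -((Real.log x / t + Real.log y / t) / Real.log 2) = -(1 / t) * Real.logb 2 (x * y) := by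
  rw [Real.logb, Real.log_mul hx.ne' hy.ne']
  ring

/-- With `ε_d = 1/log₂²(d)`, `c′_d = ε_d + √(1/3 + ε_d/2)`,
`p_d = (σ_d ⊗ σ_d)({(x,y) : |⟨x,y⟩ − 1/3| ≤ ε_d})` and
`p′_d = σ_d({z : |⟨z,e₁⟩ − c′_d| ≤ ε_d})`, one has
`lim_{d→∞} −(1/d)·log₂(p_d·p′_d) = (1/2)·log₂(27/16)`. -/
theorem limit_exponent_third_list
    (σ : ∀ d : ℕ, Measure (EuclideanSpace ℝ (Fin d)))
    (hσ : ∀ d : ℕ, 2 ≤ d → IsUniformSphereMeasure d (σ d))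
    (g : ℕ → ℝ)
    (hg : ∀ d : ℕ, ∀ hd : 2 ≤ d,
      g d = -(1 / (d : ℝ)) * Real.logb 2
        ((((σ d).prod (σ d)) {q : EuclideanSpace ℝ (Fin d) × EuclideanSpace ℝ (Fin d) |
            ‖q.1‖ = 1 ∧ ‖q.2‖ = 1 ∧
              |⟪q.1, q.2⟫ - 1 / 3| ≤ ((Real.logb 2 d) ^ 2)⁻¹}).toReal *
          ((σ d) {z | ‖z‖ = 1 ∧
            |⟪z, EuclideanSpace.single (⟨0, by omega⟩ : Fin d) (1 : ℝ)⟫ -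
                (((Real.logb 2 d) ^ 2)⁻¹ +
                  Real.sqrt (1 / 3 + ((Real.logb 2 d) ^ 2)⁻¹ / 2))| ≤
              ((Real.logb 2 d) ^ 2)⁻¹}).toReal)) :
    Filter.Tendsto g Filter.atTop (nhds ((1 / 2) * Real.logb 2 (27 / 16))) := by
  have hcast : Filter.Tendsto (fun d : ℕ => ((Real.logb 2 (d : ℝ)) ^ 2)⁻¹) Filter.atTop (nhds 0) :=
    (((Filter.tendsto_pow_atTop two_ne_zero).comp (Real.tendsto_logb_atTop (by norm_num))).comp
      tendsto_natCast_atTop_atTop).inv_tendsto_atTop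
  have hsq : Filter.Tendsto (fun d : ℕ => Real.sqrt (1 / 3 + ((Real.logb 2 (d : ℝ)) ^ 2)⁻¹ / 2))
      Filter.atTop (nhds (Real.sqrt (1 / 3))) := by
    have h := ((hcast.div_const 2).const_add (1 / 3)).sqrt
    rwa [zero_div, add_zero] at h
  have A1 := asymp (fun d => 1 / 3 - ((Real.logb 2 (d : ℝ)) ^ 2)⁻¹)
    (fun d => 1 / 3 + ((Real.logb 2 (d : ℝ)) ^ 2)⁻¹)
    (fun d => (((σ d).prod (σ d)) {q : EuclideanSpace ℝ (Fin d) × EuclideanSpace ℝ (Fin d) |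
            ‖q.1‖ = 1 ∧ ‖q.2‖ = 1 ∧
              |⟪q.1, q.2⟫ - 1 / 3| ≤ ((Real.logb 2 d) ^ 2)⁻¹}).toReal) (1 / 3)
    (by norm_num) (by norm_num) (by have h := hcast.const_sub (1 / 3); rwa [sub_zero] at h)
    (by have h := hcast.const_add (1 / 3); rwa [add_zero] at h) (fun d => by ring) (by
      intro d hd h0 h1 h2
      have he : ‖EuclideanSpace.single (⟨0, by omega⟩ : Fin d) (1 : ℝ)‖ = 1 := by simp
      simp only [prod_eq (σ d) (hσ d hd) _ _ he]
      apply band_bounds hd (σ d) (hσ d hd) _ _ h0 h1 h2 _ he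
      intro z
      rw [Set.mem_ofPred_eq, abs_le]
      constructor
      · rintro ⟨h3, h4, h5⟩
        exact ⟨h3, by linarith, by linarith⟩
      · rintro ⟨h3, h4, h5⟩
        exact ⟨h3, by linarith, by linarith⟩)
  have A2 := asymp (fun d => Real.sqrt (1 / 3 + ((Real.logb 2 (d : ℝ)) ^ 2)⁻¹ / 2))
    (fun d => Real.sqrt (1 / 3 + ((Real.logb 2 (d : ℝ)) ^ 2)⁻¹ / 2)
      + 2 * ((Real.logb 2 (d : ℝ)) ^ 2)⁻¹)
    (fun d => if hd : 2 ≤ d then ((σ d) {z | ‖z‖ = 1 ∧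
            |⟪z, EuclideanSpace.single (⟨0, by omega⟩ : Fin d) (1 : ℝ)⟫ -
                (((Real.logb 2 d) ^ 2)⁻¹ +
                  Real.sqrt (1 / 3 + ((Real.logb 2 d) ^ 2)⁻¹ / 2))| ≤
              ((Real.logb 2 d) ^ 2)⁻¹}).toReal else 0) (Real.sqrt (1 / 3))
    (by positivity) (by rw [Real.sq_sqrt (by norm_num)]; norm_num) hsq
    (by have h := hsq.add (hcast.const_mul 2); rwa [mul_zero, add_zero] at h) (fun d => rfl) (by
      intro d hd h0 h1 h2
      have he : ‖EuclideanSpace.single (⟨0, by omega⟩ : Fin d) (1 : ℝ)‖ = 1 := by simp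
      simp only [dif_pos hd]
      apply band_bounds hd (σ d) (hσ d hd) _ _ h0 h1 h2 _ he
      intro z
      rw [Set.mem_ofPred_eq, abs_le]
      constructor
      · rintro ⟨h3, h4, h5⟩
        exact ⟨h3, by linarith, by linarith⟩
      · rintro ⟨h3, h4, h5⟩
        exact ⟨h3, by linarith, by linarith⟩)
  obtain ⟨P1, T1⟩ := A1
  obtain ⟨P2, T2⟩ := A2
  have T := ((T1.add T2).div_const (Real.log 2)).neg
  have hval : -((Real.log (1 - (1 / 3) ^ 2) / 2 + Real.log (1 - (Real.sqrt (1 / 3)) ^ 2) / 2)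
      / Real.log 2) = (1 / 2) * Real.logb 2 (27 / 16) := by
    rw [Real.sq_sqrt (by norm_num), Real.logb, ← add_div, ← Real.log_mul (by norm_num) (by norm_num),
      show (27 / 16 : ℝ) = ((1 - (1 / 3) ^ 2) * (1 - 1 / 3))⁻¹ by norm_num, Real.log_inv]
    ring
  rw [hval] at T
  refine T.congr' ?_
  filter_upwards [P1, P2, Filter.eventually_ge_atTop 2] with d h1 h2 hd
  rw [hg d hd]
  simp only [dif_pos hd] at h2 ⊢
  exact final_alg _ _ _ h1 h2
end
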